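/- Let Z be a real Banach space, ν, k ≥ 1 integers, D ⊆ ℝ^ν open, and u : D → Z continuous. Suppose that for every l ≤ k, every t ∈ D and every ρ ∈ ℝ^ν the l-th directional derivative ∂_ρ^l u(t) := (d/ds)^l u(t + sρ)|_{s=0} exists, and that for each l ≤ k the map (t, ρ) ↦ ∂_ρ^l u(t) is continuous on D × ℝ^ν. Then u is C^k on D. -/

import Mathlib

open scoped Topology

section DirectionalDerivatives

open scoped ContDiff Convolution
open MeasureTheory Metric

open Finset in
/-- Polarization identity for a multilinear map. -/
theorem ContinuousMultilinearMap.sum_perm_eq_sum_powerset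
    {E F : Type*} [AddCommGroup E] [Module ℝ E] [TopologicalSpace E]
    [AddCommGroup F] [Module ℝ F] [TopologicalSpace F] {n : ℕ}
    (M : ContinuousMultilinearMap ℝ (fun _ : Fin n => E) F) (v : Fin n → E) :
    ∑ σ : Equiv.Perm (Fin n), M (v ∘ σ) =
      ∑ S : Finset (Fin n), (-1 : ℝ) ^ (n + #S) • M (fun _ => ∑ j ∈ S, v j) := by
  have key : ∀ f : Fin n → Fin n,
      (∑ S : Finset (Fin n), if (∀ i, f i ∈ S) then (-1 : ℝ) ^ (n + #S) else 0) =
        if Function.Bijective f then 1 else 0 := by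
    intro f
    by_cases hf : Function.Surjective f
    · rw [if_pos (Finite.surjective_iff_bijective.1 hf), Finset.sum_eq_single univ]
      · simp [← two_mul]
      · intro S _ hS
        rw [if_neg]
        contrapose! hS
        refine eq_univ_of_forall fun x => ?_
        obtain ⟨i, rfl⟩ := hf x
        exact hS i
      · simp
    · rw [if_neg (fun h => hf h.surjective)]
      obtain ⟨a, ha⟩ : ∃ a, ∀ i, f i ≠ a := by simpa [Function.Surjective] using hf
      refine Finset.sum_involution (fun S _ => if a ∈ S then S.erase a else insert a S)
        ?_ ?_ (by simp) ?_
      · intro S _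
        by_cases h : a ∈ S
        · have h1 := Finset.card_erase_add_one h
          simp only [h, if_true, mem_erase, ne_eq, ha, not_false_eq_true, true_and]
          split_ifs
          · rw [← h1]; ring
          · simp
        · simp only [h, if_false, mem_insert, ha, false_or, card_insert_of_notMem h]
          split_ifs
          · ring
          · simp
      · intro S _ _ h
        by_cases h' : a ∈ S
        · rw [if_pos h'] at h
          exact erase_eq_self.1 h h'
        · rw [if_neg h'] at h
          exact h' (insert_eq_self.1 h)
      · intro S _
        by_cases h' : a ∈ S <;> simp [h']
  have expand : ∀ S : Finset (Fin n), M (fun _ => ∑ j ∈ S, v j) =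
      ∑ f : Fin n → Fin n, if (∀ i, f i ∈ S) then M (v ∘ f) else 0 := by
    intro S
    rw [M.map_sum_finset (fun _ j => v j) (fun _ => S), ← Finset.sum_filter]
    refine Finset.sum_congr ?_ fun _ _ => rfl
    ext f
    simp
  simp_rw [expand, Finset.smul_sum]
  rw [Finset.sum_comm]
  have : ∀ f : Fin n → Fin n,
      (∑ S : Finset (Fin n), (-1 : ℝ) ^ (n + #S) • if (∀ i, f i ∈ S) then M (v ∘ f) else 0) =
        if Function.Bijective f then M (v ∘ f) else 0 := by
    intro f
    rw [← one_smul ℝ (M (v ∘ f)), ← ite_zero_smul, ← key f, Finset.sum_smul]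
    refine Finset.sum_congr rfl fun S _ => ?_
    split_ifs <;> simp
  simp_rw [this]
  rw [← Finset.sum_filter]
  refine Finset.sum_bij (fun σ _ => ⇑σ) ?_ ?_ ?_ ?_
  · intro σ _
    exact mem_filter.2 ⟨mem_univ _, σ.bijective⟩
  · intro σ _ τ _ h
    exact DFunLike.coe_injective h
  · intro f hf
    exact ⟨Equiv.ofBijective f ((mem_filter.1 hf).2), mem_univ _, rfl⟩
  · intros; rfl

/-- The norm of a symmetric multilinear map is controlled by its values on the diagonal. -/
theorem ContinuousMultilinearMap.norm_le_of_symmetric_of_diagonal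
    {E F : Type*} [NormedAddCommGroup E] [NormedSpace ℝ E]
    [NormedAddCommGroup F] [NormedSpace ℝ F] {n : ℕ}
    (M : ContinuousMultilinearMap ℝ (fun _ : Fin n => E) F)
    (hM : ∀ (v : Fin n → E) (σ : Equiv.Perm (Fin n)), M (v ∘ σ) = M v) {b : ℝ}
    (hb : ∀ ρ : E, ‖ρ‖ ≤ n → ‖M (fun _ => ρ)‖ ≤ b) : ‖M‖ ≤ 2 ^ n * b := by
  have hb0 : 0 ≤ b := (norm_nonneg _).trans (hb 0 (by simp))
  have unit : ∀ w : Fin n → E, (∀ i, ‖w i‖ ≤ 1) → ‖M w‖ ≤ 2 ^ n * b := by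
    intro w hw
    have h := M.sum_perm_eq_sum_powerset w
    simp only [hM, Finset.sum_const, Finset.card_univ, Fintype.card_perm, Fintype.card_fin] at h
    calc ‖M w‖ ≤ n.factorial * ‖M w‖ :=
          le_mul_of_one_le_left (norm_nonneg _) (by exact_mod_cast n.factorial_pos)
      _ = ‖n.factorial • M w‖ := by rw [← Nat.cast_smul_eq_nsmul ℝ, norm_smul]; simp
      _ ≤ ∑ S : Finset (Fin n), b := by
          rw [h]
          refine norm_sum_le_of_le _ fun S _ => ?_
          rw [norm_smul, norm_pow, norm_neg, norm_one, one_pow, one_mul]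
          refine hb _ ((norm_sum_le_of_le S fun i _ => hw i).trans ?_)
          simpa using (Finset.card_le_univ S)
      _ = 2 ^ n * b := by simp
  refine M.opNorm_le_bound (by positivity) fun v => ?_
  have hv : v = fun i => ‖v i‖ • (‖v i‖⁻¹ • v i) := by
    ext i
    by_cases h : v i = 0
    · simp [h]
    · rw [smul_inv_smul₀ (norm_ne_zero_iff.2 h)]
  conv_lhs => rw [hv, M.map_smul_univ, norm_smul, mul_comm]
  simp only [norm_prod, norm_norm]
  refine mul_le_mul_of_nonneg_right (unit _ fun i => ?_) (by positivity)
  rw [norm_smul, norm_inv, norm_norm]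
  exact inv_mul_le_one

/-- Iterated directional derivative of `f` along the vectors of a list, the head acting last. -/
noncomputable def iteratedDirDeriv {E F : Type*} [NormedAddCommGroup E] [NormedSpace ℝ E]
    [NormedAddCommGroup F] [NormedSpace ℝ F] (f : E → F) : List E → E → F
  | [] => f
  | v :: l => fun x => fderiv ℝ (iteratedDirDeriv f l) x v

section
variable {E F : Type*} [NormedAddCommGroup E] [NormedSpace ℝ E]
    [NormedAddCommGroup F] [NormedSpace ℝ F] {f : E → F}

theorem contDiff_iteratedDirDeriv (hf : ContDiff ℝ ∞ f) (l : List E) :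
    ContDiff ℝ ∞ (iteratedDirDeriv f l) := by
  induction l with
  | nil => exact hf
  | cons v l ih => exact (ih.fderiv_right (m := ∞) (by simp)).clm_apply contDiff_const

theorem iteratedDirDeriv_perm (hf : ContDiff ℝ ∞ f) {l l' : List E} (h : l.Perm l') :
    iteratedDirDeriv f l = iteratedDirDeriv f l' := by
  induction h with
  | nil => rfl
  | cons v _ ih => simp only [iteratedDirDeriv, ih]
  | trans _ _ ih₁ ih₂ => exact ih₁.trans ih₂
  | swap v w l =>
    ext x
    have hg := contDiff_iteratedDirDeriv hf l
    have hg' : Differentiable ℝ (fderiv ℝ (iteratedDirDeriv f l)) :=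
      (hg.fderiv_right (m := ∞) (by simp)).differentiable (by simp)
    have hsymm : IsSymmSndFDerivAt ℝ (iteratedDirDeriv f l) x :=
      hg.contDiffAt.isSymmSndFDerivAt (by
        simpa using WithTop.coe_le_coe.2 (le_top : (2 : ℕ∞) ≤ ⊤))
    simp only [iteratedDirDeriv]
    rw [fderiv_clm_apply (hg' x) (by fun_prop), fderiv_clm_apply (hg' x) (by fun_prop)]
    simpa using hsymm w v

theorem iteratedFDeriv_apply_eq_iteratedDirDeriv (hf : ContDiff ℝ ∞ f) {n : ℕ} (v : Fin n → E)
    (x : E) : iteratedFDeriv ℝ n f x v = iteratedDirDeriv f (List.ofFn v) x := by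
  induction n generalizing x with
  | zero => simp [iteratedDirDeriv]
  | succ n ih =>
    have hd : DifferentiableAt ℝ (iteratedFDeriv ℝ n f) x :=
      hf.differentiable_iteratedFDeriv (by exact_mod_cast ENat.natCast_lt_top n) x
    rw [iteratedFDeriv_succ_apply_left, List.ofFn_succ]
    simp only [iteratedDirDeriv]
    rw [← funext (ih fun i => v i.succ), fderiv_continuousMultilinear_apply_const_apply hd]
    rfl

theorem ContDiff.iteratedFDeriv_comp_perm_of_real (hf : ContDiff ℝ ∞ f) {n : ℕ} (v : Fin n → E)
    (σ : Equiv.Perm (Fin n)) (x : E) :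
    iteratedFDeriv ℝ n f x (v ∘ σ) = iteratedFDeriv ℝ n f x v := by
  rw [iteratedFDeriv_apply_eq_iteratedDirDeriv hf, iteratedFDeriv_apply_eq_iteratedDirDeriv hf,
    iteratedDirDeriv_perm hf (Equiv.Perm.ofFn_comp_perm σ v)]

theorem hasDerivAt_iteratedFDeriv_diagonal (hf : ContDiff ℝ ∞ f) (n : ℕ) (x ρ : E) :
    HasDerivAt (fun s : ℝ => iteratedFDeriv ℝ n f (x + s • ρ) (fun _ => ρ))
      (iteratedFDeriv ℝ (n + 1) f x (fun _ => ρ)) 0 := by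
  have hd : DifferentiableAt ℝ (iteratedFDeriv ℝ n f) x :=
    hf.differentiable_iteratedFDeriv (by exact_mod_cast ENat.natCast_lt_top n) x
  have hline : HasDerivAt (fun s : ℝ => x + s • ρ) ρ 0 := by
    simpa using ((hasDerivAt_id (0 : ℝ)).smul_const ρ).const_add x
  have h := (hd.continuousMultilinear_apply_const (fun _ => ρ)).hasFDerivAt
  rw [← show x + (0 : ℝ) • ρ = x by simp] at h
  have h' := h.comp_hasDerivAt (0 : ℝ) hline
  rw [zero_smul, add_zero, fderiv_continuousMultilinear_apply_const_apply hd] at h'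
  rw [iteratedFDeriv_succ_apply_left]
  exact h'

/-- A limit of `C^k` functions whose derivatives up to order `k` are uniformly Cauchy is `C^k`. -/
theorem contDiffOn_of_uniformCauchySeqOn_iteratedFDeriv [CompleteSpace F] {k : ℕ} {s : Set E}
    (hs : IsOpen s) {f : ℕ → E → F} {u : E → F} (hf : ∀ n, ContDiff ℝ k (f n))
    (hc : ∀ l ≤ k, UniformCauchySeqOn (fun n => iteratedFDeriv ℝ l (f n)) Filter.atTop s)
    (hu : ∀ x ∈ s, Filter.Tendsto (fun n => f n x) Filter.atTop (𝓝 (u x))) :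
    ContDiffOn ℝ k u s := by
  classical
  have hlim : ∀ l x, ∃ y, l ≤ k → x ∈ s →
      Filter.Tendsto (fun n => iteratedFDeriv ℝ l (f n) x) Filter.atTop (𝓝 y) := by
    intro l x
    by_cases h : l ≤ k ∧ x ∈ s
    · obtain ⟨y, hy⟩ := cauchySeq_tendsto_of_complete ((hc l h.1).cauchySeq h.2)
      exact ⟨y, fun _ _ => hy⟩
    · exact ⟨0, fun h₁ h₂ => absurd ⟨h₁, h₂⟩ h⟩
  choose q hq using hlim
  have hunif : ∀ l ≤ k,
      TendstoUniformlyOn (fun n => iteratedFDeriv ℝ l (f n)) (q l) Filter.atTop s :=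
    fun l hl => (hc l hl).tendstoUniformlyOn_of_tendsto fun x hx => hq l x hl hx
  have hT : HasFTaylorSeriesUpToOn k u (fun x l => q l x) s := by
    refine ⟨fun x hx => ?_, fun l hl x hx => ?_, fun l hl => ?_⟩
    · have h0 := hq 0 x (Nat.zero_le _) hx
      have h1 := ((continuousMultilinearCurryFin0 ℝ E F).continuous.tendsto _).comp h0
      refine tendsto_nhds_unique ?_ (hu x hx)
      refine h1.congr fun n => ?_
      simp
    · have hl' : l < k := by exact_mod_cast hl
      refine HasFDerivAt.hasFDerivWithinAt ?_
      refine hasFDerivAt_of_tendstoUniformlyOn (l := Filter.atTop)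
        (f := fun n => iteratedFDeriv ℝ l (f n))
        (f' := fun n x => (iteratedFDeriv ℝ (l + 1) (f n) x).curryLeft)
        (g' := fun x => (q (l + 1) x).curryLeft) hs ?_ ?_
        (fun x hx => hq l x hl'.le hx) hx
      · exact (continuousMultilinearCurryLeftEquiv ℝ (fun _ : Fin (l + 1) => E) F).isometry
          |>.uniformContinuous.comp_tendstoUniformlyOn (hunif (l + 1) hl')
      · intro n y _
        have := ((hf n).differentiable_iteratedFDeriv (m := l) (by exact_mod_cast hl') y).hasFDerivAt
        have e : (iteratedFDeriv ℝ (l + 1) (f n) y).curryLeft =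
            fderiv ℝ (iteratedFDeriv ℝ l (f n)) y := by
          ext
          rfl
        rw [e]
        exact this
    · have hl' : l ≤ k := by exact_mod_cast hl
      refine (hunif l hl').continuousOn (Filter.Eventually.frequently
        (Filter.Eventually.of_forall fun n => ?_))
      exact ((hf n).continuous_iteratedFDeriv (by exact_mod_cast hl')).continuousOn
  exact hT.contDiffOn
end

/-- Directional derivatives commute with mollification. -/
theorem hasDerivAt_normed_convolution_line {E Z : Type*} [NormedAddCommGroup E]
    [InnerProductSpace ℝ E] [FiniteDimensional ℝ E] [MeasurableSpace E] [BorelSpace E]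
    {μ : Measure E} [μ.IsAddHaarMeasure]
    [NormedAddCommGroup Z] [NormedSpace ℝ Z] {g g' : E → Z} {x₀ x ρ : E} {r R : ℝ}
    (φ : ContDiffBump (0 : E)) (hφ : φ.rOut + r ≤ R)
    (hg : ContinuousOn g (closedBall x₀ R)) (hg' : ContinuousOn g' (closedBall x₀ R))
    (hgg' : ∀ t ∈ ball x₀ R, HasDerivAt (fun s : ℝ => g (t + s • ρ)) (g' t) 0)
    (hx : x ∈ ball x₀ r) :
    HasDerivAt (fun s : ℝ =>
        (φ.normed μ ⋆[ContinuousLinearMap.lsmul ℝ ℝ, μ] (closedBall x₀ R).indicator g)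
          (x + s • ρ))
      ((φ.normed μ ⋆[ContinuousLinearMap.lsmul ℝ ℝ, μ] (closedBall x₀ R).indicator g') x) 0 := by
  have hK : IsCompact (closedBall x₀ R) := isCompact_closedBall _ _
  obtain ⟨C, hC⟩ := hK.exists_bound_of_continuousOn hg'
  have hC' : ∀ y, ‖(closedBall x₀ R).indicator g' y‖ ≤ |C| := by
    intro y
    by_cases hy : y ∈ closedBall x₀ R
    · rw [Set.indicator_of_mem hy]
      exact (hC y hy).trans (le_abs_self C)
    · rw [Set.indicator_of_notMem hy, norm_zero]
      exact abs_nonneg C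
  have hconv : ∀ {h : E → Z}, ContinuousOn h (closedBall x₀ R) → ∀ y,
      Integrable (fun z => φ.normed μ z • (closedBall x₀ R).indicator h (y - z)) μ :=
    fun {h} hh y => φ.hasCompactSupport_normed.convolutionExists_left
      (ContinuousLinearMap.lsmul ℝ ℝ) φ.continuous_normed
      ((integrable_indicator_iff measurableSet_closedBall).2
        (hh.integrableOn_compact hK)).locallyIntegrable y
  have hline : Continuous fun s : ℝ => x + s • ρ := by fun_prop
  have hs : (fun s : ℝ => x + s • ρ) ⁻¹' ball x₀ r ∈ 𝓝 (0 : ℝ) :=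
    hline.continuousAt.preimage_mem_nhds (isOpen_ball.mem_nhds (by simpa using hx))
  have key := hasDerivAt_integral_of_dominated_loc_of_deriv_le (μ := μ) (x₀ := (0 : ℝ))
    (F := fun s z => φ.normed μ z • (closedBall x₀ R).indicator g (x + s • ρ - z))
    (F' := fun s z => φ.normed μ z • (closedBall x₀ R).indicator g' (x + s • ρ - z))
    (bound := fun z => φ.normed μ z * |C|) hs
    (.of_forall fun s => (hconv hg _).aestronglyMeasurable) (hconv hg _)
    (hconv hg' _).aestronglyMeasurable
    (.of_forall fun z s _ => ?_) (φ.integrable_normed.mul_const _)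
    (.of_forall fun z s hs => ?_)
  · simpa [convolution] using key.2
  · rw [norm_smul, Real.norm_of_nonneg (φ.nonneg_normed z)]
    exact mul_le_mul_of_nonneg_left (hC' _) (φ.nonneg_normed z)
  · by_cases hz : φ.normed μ z = 0
    · simpa [hz] using hasDerivAt_const s (0 : Z)
    · have hz' : z ∈ ball (0 : E) φ.rOut := by
        rw [← φ.support_normed_eq (μ := μ)]
        exact hz
      have hp : x + s • ρ - z ∈ ball x₀ R := by
        rw [mem_ball_iff_norm] at *
        have h1 : ‖x + s • ρ - x₀‖ < r := mem_ball_iff_norm.1 hs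
        calc ‖x + s • ρ - z - x₀‖ = ‖(x + s • ρ - x₀) - (z - 0)‖ := by congr 1; abel
          _ ≤ ‖x + s • ρ - x₀‖ + ‖z - 0‖ := norm_sub_le _ _
          _ < R := by linarith
      refine HasDerivAt.const_smul _ ?_
      rw [Set.indicator_of_mem (ball_subset_closedBall hp)]
      have h := HasDerivAt.comp_sub_const (𝕜 := ℝ)
        (f := fun s' : ℝ => g (x + s • ρ - z + s' • ρ)) (f' := g' (x + s • ρ - z)) s s
        (by simpa using hgg' _ hp)
      refine h.congr_of_eventuallyEq ?_
      have hcont : Continuous fun s : ℝ => x + s • ρ - z := by fun_prop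
      filter_upwards [hcont.continuousAt.preimage_mem_nhds (isOpen_ball.mem_nhds hp)] with s' hs'
      rw [Set.indicator_of_mem (ball_subset_closedBall hs')]
      congr 1
      module

theorem contDiffOn_ball_of_directional {E Z : Type*} [NormedAddCommGroup E]
    [InnerProductSpace ℝ E] [FiniteDimensional ℝ E] [MeasurableSpace E] [BorelSpace E]
    [NormedAddCommGroup Z] [NormedSpace ℝ Z] [CompleteSpace Z] {k : ℕ} {x₀ : E} {r : ℝ}
    (hr : 0 < r) {u : E → Z} {Du : ℕ → E → E → Z} (hDu0 : ∀ t ρ, Du 0 t ρ = u t)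
    (hDu : ∀ l < k, ∀ t ∈ closedBall x₀ (r + r), ∀ ρ,
      HasDerivAt (fun s : ℝ => Du l (t + s • ρ) ρ) (Du (l + 1) t ρ) 0)
    (hDucont : ∀ l ≤ k, ContinuousOn (fun p : E × E => Du l p.1 p.2)
      (closedBall x₀ (r + r) ×ˢ Set.univ)) :
    ContDiffOn ℝ k u (ball x₀ r) := by
  let φ : ℕ → ContDiffBump (0 : E) := fun n =>
    ⟨r / (n + 2), r / (n + 1), by positivity, by gcongr; norm_num⟩
  have hφr : ∀ n, (φ n).rOut ≤ r := fun n => div_le_self hr.le (by simp)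
  have hφ0 : Filter.Tendsto (fun n => (φ n).rOut) Filter.atTop (𝓝 0) := by
    simpa [φ, div_eq_mul_inv] using
      (tendsto_one_div_add_atTop_nhds_zero_nat (𝕜 := ℝ)).const_mul r
  let K := closedBall x₀ (r + r)
  let μ : Measure E := Measure.addHaar
  let V : ℕ → ℕ → E → E → Z := fun n l ρ =>
    (φ n).normed μ ⋆[ContinuousLinearMap.lsmul ℝ ℝ, μ] K.indicator fun t => Du l t ρ
  have hcont : ∀ l ≤ k, ∀ ρ, ContinuousOn (fun t => Du l t ρ) K := fun l hl ρ =>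
    (hDucont l hl).comp (f := fun t => (t, ρ)) (by fun_prop) fun t ht => ⟨ht, trivial⟩
  have hint : ∀ l ≤ k, ∀ ρ, Integrable (K.indicator fun t => Du l t ρ) μ := fun l hl ρ =>
    (integrable_indicator_iff measurableSet_closedBall).2
      ((hcont l hl ρ).integrableOn_compact (isCompact_closedBall _ _))
  have hV0 : ∀ n ρ, V n 0 ρ = V n 0 0 := fun n ρ => by simp only [V, hDu0]
  have hsmooth : ∀ n, ContDiff ℝ ∞ (V n 0 0) := fun n =>
    (φ n).hasCompactSupport_normed.contDiff_convolution_left _ (φ n).contDiff_normed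
      (hint 0 (Nat.zero_le _) 0).locallyIntegrable
  have hdiag : ∀ n, ∀ l ≤ k, ∀ ρ, ∀ t ∈ ball x₀ r,
      iteratedFDeriv ℝ l (V n 0 0) t (fun _ => ρ) = V n l ρ t := by
    intro n l
    induction l with
    | zero => intro _ ρ t _; rw [iteratedFDeriv_zero_apply, hV0 n ρ]
    | succ l ih =>
      intro hl ρ t ht
      have h1 := hasDerivAt_iteratedFDeriv_diagonal (hsmooth n) l t ρ
      have h2 : HasDerivAt (fun s : ℝ => V n l ρ (t + s • ρ)) (V n (l + 1) ρ t) 0 :=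
        hasDerivAt_normed_convolution_line (φ n) (by linarith [hφr n])
          (hcont l (Nat.le_of_succ_le hl) ρ) (hcont (l + 1) hl ρ)
          (fun t ht => hDu l hl t (ball_subset_closedBall ht) ρ) ht
      refine h1.unique (h2.congr_of_eventuallyEq ?_)
      have hline : Continuous fun s : ℝ => t + s • ρ := by fun_prop
      filter_upwards [hline.continuousAt.preimage_mem_nhds
        (isOpen_ball.mem_nhds (show t + (0 : ℝ) • ρ ∈ ball x₀ r by simpa using ht))] with s hs
      exact ih (Nat.le_of_succ_le hl) ρ _ hs
  have happrox : ∀ l ≤ k, ∀ ε > 0, ∀ᶠ n in Filter.atTop, ∀ t ∈ ball x₀ r, ∀ ρ : E, ‖ρ‖ ≤ l →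
      dist (V n l ρ t) (Du l t ρ) ≤ ε := by
    intro l hl ε hε
    have huc := ((isCompact_closedBall x₀ (r + r)).prod
      (isCompact_closedBall (0 : E) l)).uniformContinuousOn_of_continuous
      ((hDucont l hl).mono (Set.prod_mono le_rfl (Set.subset_univ _)))
    obtain ⟨δ, hδ, h⟩ := Metric.uniformContinuousOn_iff.1 huc ε hε
    filter_upwards [hφ0.eventually_lt_const hδ] with n hn t ht ρ hρ
    have hmem : ∀ y ∈ ball t (φ n).rOut, y ∈ K := fun y hy => by
      have h1 := mem_ball.1 hy
      have h2 := mem_ball.1 ht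
      exact mem_closedBall.2 (by linarith [dist_triangle y t x₀, hφr n])
    have htK := hmem t (mem_ball_self (φ n).rOut_pos)
    have hρ' : ρ ∈ closedBall (0 : E) l := by simpa using hρ
    have := (φ n).dist_normed_convolution_le (μ := μ) (x₀ := t) (ε := ε)
      (hint l hl ρ).aestronglyMeasurable fun y hy => by
        rw [Set.indicator_of_mem (hmem y hy), Set.indicator_of_mem htK]
        refine (h (y, ρ) ⟨hmem y hy, hρ'⟩ (t, ρ) ⟨htK, hρ'⟩ ?_).le
        rw [Prod.dist_eq, dist_self, max_eq_left dist_nonneg]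
        exact (mem_ball.1 hy).trans hn
    rwa [Set.indicator_of_mem htK] at this
  refine contDiffOn_of_uniformCauchySeqOn_iteratedFDeriv isOpen_ball (f := fun n => V n 0 0)
    (fun n => (hsmooth n).of_le (mod_cast le_top)) (fun l hl => ?_) fun x hx => ?_
  · rw [Metric.uniformCauchySeqOn_iff]
    intro ε hε
    obtain ⟨N, hN⟩ := Filter.eventually_atTop.1
      (happrox l hl (ε / (2 ^ l * 4)) (by positivity))
    refine ⟨N, fun m hm n hn t ht => ?_⟩
    rw [dist_eq_norm]
    refine (ContinuousMultilinearMap.norm_le_of_symmetric_of_diagonal _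
      (b := ε / (2 ^ l * 4) + ε / (2 ^ l * 4)) (fun v σ => ?_) fun ρ hρ => ?_).trans_lt ?_
    · simp only [_root_.sub_apply,
        (hsmooth _).iteratedFDeriv_comp_perm_of_real]
    · rw [_root_.sub_apply, hdiag m l hl ρ t ht, hdiag n l hl ρ t ht,
        ← dist_eq_norm]
      exact (dist_triangle_right _ _ _).trans (add_le_add (hN m hm t ht ρ hρ) (hN n hn t ht ρ hρ))
    · field_simp
      linarith
  · rw [Metric.tendsto_nhds]
    intro ε hε
    filter_upwards [happrox 0 (Nat.zero_le _) (ε / 2) (half_pos hε)] with n hn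
    have := hn x hx 0 (by simp)
    rw [hDu0] at this
    linarith

end DirectionalDerivatives

/-- Let `Z` be a real Banach space, `ν, k ≥ 1`, `D ⊆ ℝ^ν` open and
`u : D → Z` continuous.  Suppose that for every `l ≤ k` the iterated directional derivatives
`∂_ρ^l u (t)` exist for all `t ∈ D`, `ρ ∈ ℝ^ν` (encoded by a family `Du` with `Du 0 = u` and
`Du (l+1) t ρ = (d/ds) Du l (t + s • ρ) ρ |_{s=0}`), and that for each `l ≤ k` the map
`(t, ρ) ↦ Du l t ρ` is continuous on `D × ℝ^ν`.  Then `u` is `C^k` on `D`. -/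
theorem statement1 {Z : Type*} [NormedAddCommGroup Z] [NormedSpace ℝ Z] [CompleteSpace Z]
    (ν k : ℕ) (hν : 1 ≤ ν) (hk : 1 ≤ k)
    (D : Set (EuclideanSpace ℝ (Fin ν))) (hD : IsOpen D)
    (u : EuclideanSpace ℝ (Fin ν) → Z) (hu : ContinuousOn u D)
    (Du : ℕ → EuclideanSpace ℝ (Fin ν) → EuclideanSpace ℝ (Fin ν) → Z)
    (hDu0 : ∀ t ρ, Du 0 t ρ = u t)
    (hDu : ∀ l < k, ∀ t ∈ D, ∀ ρ : EuclideanSpace ℝ (Fin ν),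
      HasDerivAt (fun s : ℝ => Du l (t + s • ρ) ρ) (Du (l + 1) t ρ) 0)
    (hDucont : ∀ l ≤ k,
      ContinuousOn (fun p : EuclideanSpace ℝ (Fin ν) × EuclideanSpace ℝ (Fin ν) => Du l p.1 p.2)
        (D ×ˢ (Set.univ : Set (EuclideanSpace ℝ (Fin ν))))) :
    ContDiffOn ℝ k u D := by
  intro x hx
  obtain ⟨ε, hε, hball⟩ := Metric.nhds_basis_closedBall.mem_iff.1 (hD.mem_nhds hx)
  have hsub : Metric.closedBall x (ε / 2 + ε / 2) ⊆ D := by rwa [add_halves]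
  have h := contDiffOn_ball_of_directional (half_pos hε) hDu0
    (fun l hl t ht => hDu l hl t (hsub ht))
    (fun l hl => (hDucont l hl).mono (Set.prod_mono hsub le_rfl))
  exact (h.contDiffAt (Metric.ball_mem_nhds x (half_pos hε))).contDiffWithinAt
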